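/- There exists an absolute constant C' > 0 with the following property. Let τ ≥ 1 be a real number, let r ≥ 2 and m ≥ 1 be integers, let U and T be disjoint finite sets of positive real numbers with |T| = r, for each μ ∈ U let A_μ be a finite set of positive reals with |A_μ| ≤ 2τ, and for each λ ∈ T let X_λ be a finite set of positive reals with |X_λ| = m. Suppose that C'·|U|²·τ^(43/25) < m²/(e·(2r − 3)), where e is Euler's number. Then one can choose an element a_λ ∈ X_λ for every λ ∈ T such that for all λ₃, λ₄ ∈ T with λ₃ ≠ λ₄ and all λ₁, λ₂ ∈ U, |{(x, y) ∈ A_{λ₁} × A_{λ₂} : (λ₃·a_{λ₃} + λ₁x)(a_{λ₄} + y) = (λ₄·a_{λ₄} + λ₂y)(a_{λ₃} + x)}| ≤ τ^(19/25). -/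

import Mathlib

open scoped Classical

/-- Functions choosing an element of each `X i`, with no related pair of values inside `S`. -/
noncomputable def goodChoices {ι α : Type*} [Fintype ι] (X : ι → Finset α)
    (R : ι → ι → α → α → Prop) (S : Finset ι) : Finset (ι → α) :=
  (Fintype.piFinset X).filter fun f => ∀ i ∈ S, ∀ j ∈ S, i ≠ j → ¬ R i j (f i) (f j)

/-- The coordinates outside `S` of a good choice for `S` are independent of the others. -/
lemma card_goodChoices_filter_mul_le {ι α : Type*} [Fintype ι] (X : ι → Finset α)
    (R : ι → ι → α → α → Prop) (S : Finset ι) {v w : ι} (hvw : v ≠ w) (hv : v ∉ S) (hw : w ∉ S) :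
    ((goodChoices X R S).filter fun f => R v w (f v) (f w)).card * ((X v).card * (X w).card) ≤
      ((X v ×ˢ X w).filter fun z => R v w z.1 z.2).card * (goodChoices X R S).card := by
  rw [← Finset.card_product, ← Finset.card_product, ← Finset.card_product]
  refine Finset.card_le_card_of_injOn
    (fun p => ((p.1 v, p.1 w), Function.update (Function.update p.1 v p.2.1) w p.2.2)) ?_ ?_
  · rintro ⟨f, c, d⟩ hp
    simp only [goodChoices, Finset.coe_product, Set.mem_prod, Finset.mem_coe, Finset.mem_filter,
      Fintype.mem_piFinset, Finset.mem_product] at hp ⊢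
    obtain ⟨⟨⟨hf, hS⟩, hR⟩, hc, hd⟩ := hp
    refine ⟨⟨⟨hf v, hf w⟩, hR⟩, ?_, ?_⟩
    · intro i
      by_cases h1 : i = w
      · subst h1; simpa using hd
      · by_cases h2 : i = v
        · subst h2; simpa [h1] using hc
        · simpa [h1, h2] using hf i
    · intro i hi j hj hij
      have e : ∀ k ∈ S, Function.update (Function.update f v c) w d k = f k := by
        intro k hk
        rw [Function.update_of_ne (ne_of_mem_of_not_mem hk hw),
          Function.update_of_ne (ne_of_mem_of_not_mem hk hv)]
      rw [e i hi, e j hj]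
      exact hS i hi j hj hij
  · rintro ⟨f, c, d⟩ - ⟨g, c', d'⟩ - h
    simp only [Prod.mk.injEq] at h ⊢
    obtain ⟨⟨h1, h2⟩, h3⟩ := h
    refine ⟨?_, ?_, ?_⟩
    · funext i
      by_cases hi : i = w
      · rw [hi, h2]
      · by_cases hi' : i = v
        · rw [hi', h1]
        · have := congrFun h3 i
          simpa [hi, hi'] using this
    · have := congrFun h3 v
      simpa [hvw] using this
    · have := congrFun h3 w
      simpa using this

lemma card_goodChoices_le_two_mul {ι α : Type*} [Fintype ι] (X : ι → Finset α) {m : ℕ}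
    (hm : 0 < m) (hX : ∀ i, (X i).card = m) (R : ι → ι → α → α → Prop)
    (hsymm : ∀ i j a b, R i j a b → R j i b a) {D : ℝ}
    (hD : ∀ i j, i ≠ j → (((X i ×ˢ X j).filter fun z => R i j z.1 z.2).card : ℝ) ≤ D)
    (h : 4 * (Fintype.card ι : ℝ) * D ≤ (m : ℝ) ^ 2) (S : Finset ι) :
    ∀ v, v ∉ S →
      ((goodChoices X R S).card : ℝ) ≤ 2 * ((goodChoices X R (insert v S)).card : ℝ) := by
  induction S using Finset.strongInduction with
  | H S ih =>
  intro v hv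
  have hm' : (0 : ℝ) < m := by exact_mod_cast hm
  rcases S.eq_empty_or_nonempty with rfl | ⟨w0, hw0⟩
  · have : goodChoices X R (insert v ∅) = goodChoices X R ∅ := by
      unfold goodChoices
      refine Finset.filter_congr fun f _ => ?_
      simp
    rw [this]
    have : (0 : ℝ) ≤ ((goodChoices X R ∅).card : ℝ) := by positivity
    linarith
  have hD0 : 0 ≤ D := le_trans (by positivity) (hD v w0 (fun e => hv (e ▸ hw0)))
  have hsub : goodChoices X R S ⊆ goodChoices X R (insert v S) ∪
      S.biUnion fun w => (goodChoices X R (S.erase w)).filter fun f => R v w (f v) (f w) := by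
    intro f hf
    rw [Finset.mem_union, or_iff_not_imp_right]
    intro hn
    simp only [Finset.mem_biUnion, Finset.mem_filter, not_exists, not_and, goodChoices] at hn hf ⊢
    have key : ∀ w ∈ S, ¬ R v w (f v) (f w) := fun w hw => hn w hw ⟨hf.1, fun i hi j hj =>
      hf.2 i (Finset.mem_of_mem_erase hi) j (Finset.mem_of_mem_erase hj)⟩
    refine ⟨hf.1, fun i hi j hj hij => ?_⟩
    rcases Finset.mem_insert.1 hi with rfl | hi'
    · rcases Finset.mem_insert.1 hj with rfl | hj'
      · exact absurd rfl hij
      · exact key j hj'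
    · rcases Finset.mem_insert.1 hj with rfl | hj'
      · exact fun hR => key i hi' (hsymm _ _ _ _ hR)
      · exact hf.2 i hi' j hj' hij
  have hcard : ((goodChoices X R S).card : ℝ) ≤ ((goodChoices X R (insert v S)).card : ℝ) +
      ∑ w ∈ S, (((goodChoices X R (S.erase w)).filter fun f => R v w (f v) (f w)).card : ℝ) := by
    have h1 := (Finset.card_le_card hsub).trans (Finset.card_union_le _ _)
    have h2 := h1.trans (Nat.add_le_add_left Finset.card_biUnion_le _)
    exact_mod_cast h2
  set N : ℝ := ((goodChoices X R S).card : ℝ) with hN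
  have hN0 : 0 ≤ N := by positivity
  have hterm : ∀ w ∈ S,
      (((goodChoices X R (S.erase w)).filter fun f => R v w (f v) (f w)).card : ℝ) ≤
        2 * D * N / (m : ℝ) ^ 2 := by
    intro w hw
    have hvw : v ≠ w := fun e => hv (e ▸ hw)
    have h1 := card_goodChoices_filter_mul_le X R (S.erase w) hvw
      (fun hh => hv (Finset.mem_of_mem_erase hh)) (Finset.notMem_erase w S)
    rw [hX, hX] at h1
    have h2 := ih (S.erase w) (Finset.erase_ssubset hw) w (Finset.notMem_erase w S)
    rw [Finset.insert_erase hw, ← hN] at h2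
    have h3 := hD v w hvw
    rw [le_div_iff₀ (by positivity)]
    calc _ = (((goodChoices X R (S.erase w)).filter fun f => R v w (f v) (f w)).card : ℝ) *
          ((m : ℝ) * m) := by ring
      _ ≤ (((X v ×ˢ X w).filter fun z => R v w z.1 z.2).card : ℝ) *
          (goodChoices X R (S.erase w)).card := by exact_mod_cast h1
      _ ≤ D * (2 * N) := by gcongr
      _ = _ := by ring
  have hsum := Finset.sum_le_sum hterm
  rw [Finset.sum_const, nsmul_eq_mul] at hsum
  have hS : (S.card : ℝ) ≤ Fintype.card ι := by exact_mod_cast S.card_le_univ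
  have : (S.card : ℝ) * (2 * D * N / (m : ℝ) ^ 2) ≤ N / 2 := by
    rw [← mul_div_assoc, div_le_iff₀ (by positivity)]
    have h4 : 4 * (S.card : ℝ) * D ≤ (m : ℝ) ^ 2 := le_trans (by gcongr) h
    nlinarith [mul_le_mul_of_nonneg_right h4 hN0]
  linarith

/-- A transversal of sets of size `m` avoiding a sparse family of forbidden pairs. -/
lemma exists_transversal {ι α : Type*} [Fintype ι] (X : ι → Finset α) {m : ℕ}
    (hm : 0 < m) (hX : ∀ i, (X i).card = m) (R : ι → ι → α → α → Prop)
    (hsymm : ∀ i j a b, R i j a b → R j i b a) {D : ℝ}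
    (hD : ∀ i j, i ≠ j → (((X i ×ˢ X j).filter fun z => R i j z.1 z.2).card : ℝ) ≤ D)
    (h : 4 * (Fintype.card ι : ℝ) * D ≤ (m : ℝ) ^ 2) :
    ∃ f : ι → α, (∀ i, f i ∈ X i) ∧ ∀ i j, i ≠ j → ¬ R i j (f i) (f j) := by
  have hpos : ∀ S : Finset ι, (0 : ℝ) < (goodChoices X R S).card := by
    intro S
    induction S using Finset.induction_on with
    | empty =>
      have : goodChoices X R ∅ = Fintype.piFinset X := by simp [goodChoices]
      rw [this, Fintype.card_piFinset]
      simp only [hX]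
      have : (0 : ℝ) < m := by exact_mod_cast hm
      push_cast
      positivity
    | insert v S hv ih =>
      have := card_goodChoices_le_two_mul X hm hX R hsymm hD h S v hv
      linarith
  have h1 : 0 < (goodChoices X R Finset.univ).card := by exact_mod_cast hpos Finset.univ
  obtain ⟨f, hf⟩ := Finset.card_pos.1 h1
  simp only [goodChoices, Finset.mem_filter, Fintype.mem_piFinset, Finset.mem_univ,
    true_imp_iff] at hf
  exact ⟨f, hf⟩

/-- The index of the block of length `M` containing `x` when `B` is cut into blocks in
increasing order. -/
noncomputable def blockIndex (B : Finset ℝ) (M : ℕ) (x : ℝ) : ℕ :=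
  (B.filter fun y => y < x).card / M

lemma blockIndex_mono (B : Finset ℝ) (M : ℕ) : Monotone (blockIndex B M) := by
  intro x y hxy
  refine Nat.div_le_div_right (Finset.card_le_card fun z hz => ?_)
  rw [Finset.mem_filter] at hz ⊢
  exact ⟨hz.1, hz.2.trans_le hxy⟩

lemma blockIndex_le (B : Finset ℝ) (M : ℕ) (x : ℝ) : blockIndex B M x ≤ B.card / M :=
  Nat.div_le_div_right (Finset.card_filter_le _ _)

lemma card_blockIndex_eq_le (B : Finset ℝ) {M : ℕ} (hM : 0 < M) (c : ℕ) :
    (B.filter fun y => blockIndex B M y = c).card ≤ M := by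
  have h := Finset.card_le_card_of_injOn (s := B.filter fun y => blockIndex B M y = c)
    (t := Finset.Ico (c * M) (c * M + M)) (fun x => (B.filter fun y => y < x).card) ?_ ?_
  · simpa using h
  · intro x hx
    rw [Finset.mem_coe, Finset.mem_filter, blockIndex] at hx
    have h1 := Nat.div_add_mod (B.filter fun y => y < x).card M
    have h2 := Nat.mod_lt (B.filter fun y => y < x).card hM
    rw [hx.2, mul_comm] at h1
    simp only [Finset.coe_Ico, Set.mem_Ico]
    omega
  · have key : ∀ x ∈ B, ∀ y, x < y →
        (B.filter fun z => z < x).card < (B.filter fun z => z < y).card := by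
      intro x hx y hxy
      refine Finset.card_lt_card ?_
      rw [Finset.ssubset_iff_of_subset]
      · exact ⟨x, by simp [hx, hxy], by simp⟩
      · intro z hz
        rw [Finset.mem_filter] at hz ⊢
        exact ⟨hz.1, hz.2.trans hxy⟩
    intro x hx y hy hxy
    simp only [Finset.mem_coe, Finset.mem_filter] at hx hy
    rcases lt_trichotomy x y with hlt | heq | hlt
    · exact absurd hxy (key x hx.1 y hlt).ne
    · exact heq
    · exact absurd hxy (key y hy.1 x hlt).ne'

/-- Two points lie in the same cell of the grid cut out by the blocks of `A` and `B`. -/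
def SameCell (A B : Finset ℝ) (M : ℕ) (p q : ℝ × ℝ) : Prop :=
  blockIndex A M p.1 = blockIndex A M q.1 ∧ blockIndex B M p.2 = blockIndex B M q.2

/-- A monotone or antitone curve meets few cells of a grid. -/
lemma card_image_cell_le (A B : Finset ℝ) (M : ℕ) (K : Finset (ℝ × ℝ))
    (hK : (∀ p ∈ K, ∀ q ∈ K, p.1 ≤ q.1 → p.2 ≤ q.2) ∨
      (∀ p ∈ K, ∀ q ∈ K, p.1 ≤ q.1 → q.2 ≤ p.2)) :
    (K.image fun p => (blockIndex A M p.1, blockIndex B M p.2)).card ≤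
      A.card / M + B.card / M + 1 := by
  rw [← Finset.card_range (A.card / M + B.card / M + 1)]
  rcases hK with hK | hK
  · refine Finset.card_le_card_of_injOn (fun c => c.1 + c.2) ?_ ?_
    · intro c hc
      rw [Finset.mem_coe, Finset.mem_image] at hc
      obtain ⟨p, -, rfl⟩ := hc
      have h1 := blockIndex_le A M p.1
      have h2 := blockIndex_le B M p.2
      simp only [Finset.coe_range, Set.mem_Iio]
      omega
    · intro c hc d hd h
      rw [Finset.mem_coe, Finset.mem_image] at hc hd
      obtain ⟨p, hp, rfl⟩ := hc
      obtain ⟨q, hq, rfl⟩ := hd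
      simp only [Prod.mk.injEq] at h ⊢
      rcases le_total p.1 q.1 with hpq | hpq
      · have h1 := blockIndex_mono A M hpq
        have h2 := blockIndex_mono B M (hK p hp q hq hpq)
        omega
      · have h1 := blockIndex_mono A M hpq
        have h2 := blockIndex_mono B M (hK q hq p hp hpq)
        omega
  · refine Finset.card_le_card_of_injOn (fun c => c.1 + (B.card / M - c.2)) ?_ ?_
    · intro c hc
      rw [Finset.mem_coe, Finset.mem_image] at hc
      obtain ⟨p, -, rfl⟩ := hc
      have h1 := blockIndex_le A M p.1
      simp only [Finset.coe_range, Set.mem_Iio]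
      generalize A.card / M = u at *
      generalize B.card / M = v at *
      omega
    · intro c hc d hd h
      rw [Finset.mem_coe, Finset.mem_image] at hc hd
      obtain ⟨p, hp, rfl⟩ := hc
      obtain ⟨q, hq, rfl⟩ := hd
      simp only [Prod.mk.injEq] at h ⊢
      have h3 := blockIndex_le B M p.2
      have h4 := blockIndex_le B M q.2
      rcases le_total p.1 q.1 with hpq | hpq
      · have h1 := blockIndex_mono A M hpq
        have h2 := blockIndex_mono B M (hK p hp q hq hpq)
        omega
      · have h1 := blockIndex_mono A M hpq
        have h2 := blockIndex_mono B M (hK q hq p hp hpq)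
        omega

/-- A finite set has many pairs of distinct points with the same value of `c`, unless `c` takes
many values on it. -/
lemma card_le_card_collisions_add {α β : Type*} [DecidableEq β] (K : Finset α) (c : α → β) :
    K.card ≤ ((K ×ˢ K).filter fun z => z.1 ≠ z.2 ∧ c z.1 = c z.2).card + (K.image c).card := by
  rcases K.eq_empty_or_nonempty with rfl | ⟨x0, hx0⟩
  · simp
  have : Nonempty α := ⟨x0⟩
  have hg : ∀ p ∈ K, Function.invFunOn c (K : Set α) (c p) ∈ K ∧
      c (Function.invFunOn c (K : Set α) (c p)) = c p := fun p hp =>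
    Function.invFunOn_pos (s := (K : Set α)) ⟨p, hp, rfl⟩
  set g := Function.invFunOn c (K : Set α)
  rw [← Finset.card_filter_add_card_filter_not (s := K) (fun p => g (c p) ≠ p)]
  refine Nat.add_le_add ?_ ?_
  · refine Finset.card_le_card_of_injOn (fun p => (g (c p), p)) ?_ ?_
    · intro p hp
      simp only [Finset.mem_coe, Finset.mem_filter, Finset.mem_product] at hp ⊢
      exact ⟨⟨(hg p hp.1).1, hp.1⟩, hp.2, (hg p hp.1).2⟩
    · intro p _ q _ h
      exact (Prod.mk.inj h).2
  · refine Finset.card_le_card_of_injOn c ?_ ?_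
    · intro p hp
      rw [Finset.mem_coe, Finset.mem_filter] at hp
      exact Finset.mem_coe.2 (Finset.mem_image_of_mem c hp.1)
    · intro p hp q hq h
      rw [Finset.mem_coe, Finset.mem_filter, not_not] at hp hq
      rw [← hp.2, ← hq.2, h]

lemma card_sameCell_le (A B : Finset ℝ) {M : ℕ} (hM : 0 < M) :
    (((A ×ˢ B) ×ˢ (A ×ˢ B)).filter fun z => z.1 ≠ z.2 ∧ SameCell A B M z.1 z.2).card ≤
      A.card * B.card * (M * M) := by
  rw [← Finset.card_product]
  rw [Finset.card_filter, Finset.sum_product]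
  refine Finset.sum_le_card_nsmul _ _ _ fun p _ => ?_
  rw [← Finset.card_filter]
  refine le_trans (Finset.card_le_card (t :=
    (A.filter fun y => blockIndex A M y = blockIndex A M p.1) ×ˢ
      (B.filter fun y => blockIndex B M y = blockIndex B M p.2)) ?_) ?_
  · intro q hq
    simp only [Finset.mem_filter, Finset.mem_product] at hq ⊢
    exact ⟨⟨hq.1.1, hq.2.2.1.symm⟩, hq.1.2, hq.2.2.2.symm⟩
  · rw [Finset.card_product]
    exact Nat.mul_le_mul (card_blockIndex_eq_le A hM _) (card_blockIndex_eq_le B hM _)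

/-- A bound for the number of rich monotone curves on a Cartesian product, when two points
determine at most two of the curves. -/
lemma card_rich_curves_le {γ : Type*} (A B : Finset ℝ) (Z : Finset γ) (I : γ → ℝ × ℝ → Prop)
    {τ t : ℝ} (ht : 1 ≤ t) (htτ : t ≤ τ) (hA : (A.card : ℝ) ≤ 2 * τ) (hB : (B.card : ℝ) ≤ 2 * τ)
    (hrich : ∀ z ∈ Z, t < (((A ×ˢ B).filter (I z)).card : ℝ))
    (hmono : ∀ z ∈ Z,
      (∀ p ∈ (A ×ˢ B).filter (I z), ∀ q ∈ (A ×ˢ B).filter (I z), p.1 ≤ q.1 → p.2 ≤ q.2) ∨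
      (∀ p ∈ (A ×ˢ B).filter (I z), ∀ q ∈ (A ×ˢ B).filter (I z), p.1 ≤ q.1 → q.2 ≤ p.2))
    (htwo : ∀ p ∈ A ×ˢ B, ∀ q ∈ A ×ˢ B, p ≠ q → (Z.filter fun z => I z p ∧ I z q).card ≤ 2) :
    (Z.card : ℝ) ≤ 9248 * τ ^ 4 / t ^ 3 := by
  have ht0 : 0 < t := by linarith
  have hτ0 : 0 < τ := by linarith
  set M : ℕ := ⌈16 * τ / t⌉₊
  have hMge : 16 * τ / t ≤ M := Nat.le_ceil _
  have hMle : (M : ℝ) ≤ 17 * τ / t := by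
    have h1 := Nat.ceil_lt_add_one (a := 16 * τ / t) (by positivity)
    have h2 : 1 ≤ τ / t := by rwa [le_div_iff₀ ht0, one_mul]
    have h3 : 17 * τ / t = 16 * τ / t + τ / t := by ring
    linarith
  have hM0' : (0 : ℝ) < M := lt_of_lt_of_le (by positivity) hMge
  have hM0 : 0 < M := by exact_mod_cast hM0'
  set Q := ((A ×ˢ B) ×ˢ (A ×ˢ B)).filter fun z => z.1 ≠ z.2 ∧ SameCell A B M z.1 z.2 with hQ
  have hlow : ∀ z ∈ Z, t / 4 ≤ ((Q.filter fun w => I z w.1 ∧ I z w.2).card : ℝ) := by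
    intro z hz
    have h1 := card_le_card_collisions_add ((A ×ˢ B).filter (I z))
      (fun p => (blockIndex A M p.1, blockIndex B M p.2))
    have h2 := card_image_cell_le A B M _ (hmono z hz)
    have h3 := h1.trans (Nat.add_le_add (Finset.card_le_card
      (t := Q.filter fun w => I z w.1 ∧ I z w.2) fun w hw => ?_) h2)
    swap
    · simp only [hQ, Finset.mem_filter, Finset.mem_product, Prod.mk.injEq] at hw ⊢
      exact ⟨⟨⟨hw.1.1.1, hw.1.2.1⟩, hw.2⟩, hw.1.1.2, hw.1.2.2⟩
    set k := ((A ×ˢ B).filter (I z)).card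
    have h4 : (k : ℝ) ≤ ((Q.filter fun w => I z w.1 ∧ I z w.2).card : ℝ) +
        (((A.card / M : ℕ) : ℝ) + ((B.card / M : ℕ) : ℝ) + 1) := by
      exact_mod_cast h3
    have h5 : ∀ n : ℕ, (n : ℝ) ≤ 2 * τ → ((n / M : ℕ) : ℝ) ≤ t / 8 := by
      intro n hn
      refine Nat.cast_div_le.trans ?_
      rw [div_le_iff₀ hM0']
      rw [div_le_iff₀ ht0] at hMge
      linarith
    have h6 := hrich z hz
    have h7 : (2 : ℝ) ≤ k := by
      have : (1 : ℝ) < k := by linarith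
      have : 1 < k := by exact_mod_cast this
      exact_mod_cast this
    have := h5 _ hA
    have := h5 _ hB
    linarith
  have hdc : ∑ z ∈ Z, (Q.filter fun w => I z w.1 ∧ I z w.2).card =
      ∑ w ∈ Q, (Z.filter fun z => I z w.1 ∧ I z w.2).card := by
    simp only [Finset.card_filter]
    exact Finset.sum_comm
  have hup : ∑ w ∈ Q, (Z.filter fun z => I z w.1 ∧ I z w.2).card ≤ Q.card * 2 := by
    refine Finset.sum_le_card_nsmul _ _ _ fun w hw => ?_
    rw [hQ, Finset.mem_filter, Finset.mem_product] at hw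
    exact htwo _ hw.1.1 _ hw.1.2 hw.2.1
  have hsum : (Z.card : ℝ) * (t / 4) ≤ (Q.card : ℝ) * 2 := by
    rw [← nsmul_eq_mul]
    refine (Finset.card_nsmul_le_sum Z _ _ hlow).trans ?_
    exact_mod_cast hdc.trans_le hup
  have hQc : (Q.card : ℝ) ≤ (2 * τ) * (2 * τ) * ((17 * τ / t) * (17 * τ / t)) := by
    calc (Q.card : ℝ) ≤ (A.card : ℝ) * B.card * ((M : ℝ) * M) := by
          exact_mod_cast card_sameCell_le A B hM0
      _ ≤ _ := by gcongr
  rw [le_div_iff₀ (by positivity)]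
  have e : (2 * τ) * (2 * τ) * ((17 * τ / t) * (17 * τ / t)) * t ^ 2 = 1156 * τ ^ 4 := by
    field_simp
    norm_num
  have h1 : (Q.card : ℝ) * t ^ 2 ≤ 1156 * τ ^ 4 := by
    rw [← e]; gcongr
  nlinarith [mul_le_mul_of_nonneg_right hsum (sq_nonneg t)]

/-- The point `z` lies on the curve with parameters `a`, `b`: the vector sums with base points on
the lines of slopes `l3`, `l4` have equal slopes. -/
def OnCurve (l1 l2 l3 l4 a b : ℝ) (z : ℝ × ℝ) : Prop :=
  (l3 * a + l1 * z.1) * (b + z.2) = (l4 * b + l2 * z.2) * (a + z.1)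

lemma OnCurve.sub_eq {l1 l2 l3 l4 a b : ℝ} {p q : ℝ × ℝ} (hp : OnCurve l1 l2 l3 l4 a b p)
    (hq : OnCurve l1 l2 l3 l4 a b q) :
    (l1 - l3) * (a * ((b + p.2) * (b + q.2))) * (p.1 - q.1) =
      (l2 - l4) * (b * ((a + p.1) * (a + q.1))) * (p.2 - q.2) := by
  unfold OnCurve at hp hq
  linear_combination (a + q.1) * (b + q.2) * hp - (a + p.1) * (b + p.2) * hq

lemma OnCurve.swap_iff {l1 l2 l3 l4 a b : ℝ} {z : ℝ × ℝ} :
    OnCurve l2 l1 l4 l3 b a z.swap ↔ OnCurve l1 l2 l3 l4 a b z := by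
  unfold OnCurve
  exact eq_comm

lemma OnCurve.ne {l1 l2 l3 l4 a b : ℝ} {p q : ℝ × ℝ} (ha : 0 < a) (hb : 0 < b)
    (hp1 : 0 < p.1) (hp2 : 0 < p.2) (hq1 : 0 < q.1) (hq2 : 0 < q.2) (h13 : l1 ≠ l3)
    (h24 : l2 ≠ l4) (hp : OnCurve l1 l2 l3 l4 a b p) (hq : OnCurve l1 l2 l3 l4 a b q)
    (hpq : p ≠ q) : p.1 ≠ q.1 ∧ p.2 ≠ q.2 := by
  have h := hp.sub_eq hq
  have h1 : l1 - l3 ≠ 0 := sub_ne_zero.2 h13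
  have h2 : l2 - l4 ≠ 0 := sub_ne_zero.2 h24
  have c1 : a * ((b + p.2) * (b + q.2)) ≠ 0 := by positivity
  have c2 : b * ((a + p.1) * (a + q.1)) ≠ 0 := by positivity
  constructor
  · intro e
    rw [e, sub_self, mul_zero, eq_comm, mul_eq_zero] at h
    rw [e] at c2
    exact hpq (Prod.ext e (sub_eq_zero.1 (h.resolve_left (mul_ne_zero h2 c2))))
  · intro e
    rw [e, sub_self, mul_zero, mul_eq_zero] at h
    rw [e] at c1
    exact hpq (Prod.ext (sub_eq_zero.1 (h.resolve_left (mul_ne_zero h1 c1))) e)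

lemma OnCurve.mono_or_anti {l1 l2 l3 l4 a b : ℝ} (ha : 0 < a) (hb : 0 < b) (h13 : l1 ≠ l3)
    (h24 : l2 ≠ l4) (K : Finset (ℝ × ℝ)) (hpos : ∀ p ∈ K, 0 < p.1 ∧ 0 < p.2)
    (hK : ∀ p ∈ K, OnCurve l1 l2 l3 l4 a b p) :
    (∀ p ∈ K, ∀ q ∈ K, p.1 ≤ q.1 → p.2 ≤ q.2) ∨ (∀ p ∈ K, ∀ q ∈ K, p.1 ≤ q.1 → q.2 ≤ p.2) := by
  have h1 : l1 - l3 ≠ 0 := sub_ne_zero.2 h13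
  have h2 : l2 - l4 ≠ 0 := sub_ne_zero.2 h24
  have key : ∀ p ∈ K, ∀ q ∈ K, ∃ c d : ℝ, 0 < c ∧ 0 < d ∧
      (l1 - l3) * (l2 - l4) * c * (p.1 - q.1) = d * (p.2 - q.2) := by
    intro p hp q hq
    obtain ⟨hp1, hp2⟩ := hpos p hp
    obtain ⟨hq1, hq2⟩ := hpos q hq
    refine ⟨a * ((b + p.2) * (b + q.2)), (l2 - l4) ^ 2 * (b * ((a + p.1) * (a + q.1))),
      by positivity, by positivity, ?_⟩
    linear_combination (l2 - l4) * (hK p hp).sub_eq (hK q hq)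
  rcases lt_or_gt_of_ne (mul_ne_zero h1 h2) with hs | hs
  · right
    intro p hp q hq hpq
    obtain ⟨c, d, hc, hd, e⟩ := key p hp q hq
    have h0 : 0 ≤ (l1 - l3) * (l2 - l4) * c * (p.1 - q.1) :=
      mul_nonneg_of_nonpos_of_nonpos (mul_nonpos_of_nonpos_of_nonneg hs.le hc.le)
        (sub_nonpos.2 hpq)
    rw [e] at h0
    exact sub_nonneg.1 (nonneg_of_mul_nonneg_right h0 hd)
  · left
    intro p hp q hq hpq
    obtain ⟨c, d, hc, hd, e⟩ := key p hp q hq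
    have h0 : 0 ≤ (l1 - l3) * (l2 - l4) * c * (q.1 - p.1) :=
      mul_nonneg (mul_nonneg hs.le hc.le) (sub_nonneg.2 hpq)
    have h3 : 0 ≤ d * (q.2 - p.2) := by linarith
    exact sub_nonneg.1 (nonneg_of_mul_nonneg_right h3 hd)

lemma quadratic_leading_coeff_eq_zero {k l n x y z : ℝ} (hxy : x ≠ y) (hxz : x ≠ z) (hyz : y ≠ z)
    (hx : k * x ^ 2 + l * x + n = 0) (hy : k * y ^ 2 + l * y + n = 0)
    (hz : k * z ^ 2 + l * z + n = 0) : k = 0 := by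
  have h : k * ((x - y) * (x - z) * (y - z)) = 0 := by
    linear_combination (y - z) * hx - (x - z) * hy + (x - y) * hz
  exact (mul_eq_zero.1 h).resolve_right (mul_ne_zero (mul_ne_zero (sub_ne_zero.2 hxy)
    (sub_ne_zero.2 hxz)) (sub_ne_zero.2 hyz))

/-- Two distinct points lie on at most two of the curves. -/
lemma card_onCurve_le_two {l1 l2 l3 l4 : ℝ} (h13 : l1 ≠ l3) (h24 : l2 ≠ l4) (h34 : l3 ≠ l4)
    (h14 : l1 ≠ l4) (h23 : l2 ≠ l3) (Z : Finset (ℝ × ℝ)) (hZ : ∀ c ∈ Z, 0 < c.1 ∧ 0 < c.2)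
    {p q : ℝ × ℝ} (hp1 : 0 < p.1) (hp2 : 0 < p.2) (hq1 : 0 < q.1) (hq2 : 0 < q.2) (hpq : p ≠ q) :
    (Z.filter fun c => OnCurve l1 l2 l3 l4 c.1 c.2 p ∧ OnCurve l1 l2 l3 l4 c.1 c.2 q).card ≤ 2 := by
  by_contra hcon
  rw [not_le, Finset.two_lt_card_iff] at hcon
  obtain ⟨c, d, e, hc, hd, he, hcd, hce, hde⟩ := hcon
  rw [Finset.mem_filter] at hc hd he
  obtain ⟨hx, hy⟩ := OnCurve.ne (hZ c hc.1).1 (hZ c hc.1).2 hp1 hp2 hq1 hq2 h13 h24 hc.2.1 hc.2.2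
    hpq
  have hγ : (l1 - l4) * (p.1 - q.1) ≠ 0 := mul_ne_zero (sub_ne_zero.2 h14) (sub_ne_zero.2 hx)
  have lin : ∀ c : ℝ × ℝ, OnCurve l1 l2 l3 l4 c.1 c.2 p ∧ OnCurve l1 l2 l3 l4 c.1 c.2 q →
      (l1 - l4) * (p.1 - q.1) * c.2 =
        -((l3 - l2) * (p.2 - q.2) * c.1) - (l1 - l2) * (p.1 * p.2 - q.1 * q.2) := by
    rintro c ⟨h1, h2⟩
    unfold OnCurve at h1 h2
    linear_combination h1 - h2
  have inj : ∀ c d : ℝ × ℝ, OnCurve l1 l2 l3 l4 c.1 c.2 p ∧ OnCurve l1 l2 l3 l4 c.1 c.2 q →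
      OnCurve l1 l2 l3 l4 d.1 d.2 p ∧ OnCurve l1 l2 l3 l4 d.1 d.2 q → c ≠ d → c.1 ≠ d.1 := by
    intro c d hc hd hcd h
    refine hcd (Prod.ext h (mul_left_cancel₀ hγ ?_))
    rw [lin c hc, lin d hd, h]
  have quad : ∀ c : ℝ × ℝ, OnCurve l1 l2 l3 l4 c.1 c.2 p ∧ OnCurve l1 l2 l3 l4 c.1 c.2 q →
      (-(l3 - l4) * (l3 - l2) * (p.2 - q.2)) * c.1 ^ 2 +
      (-(l3 - l4) * (l1 - l2) * (p.1 * p.2 - q.1 * q.2) +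
        (l3 - l2) * p.2 * ((l1 - l4) * (p.1 - q.1)) -
        (l1 - l4) * p.1 * ((l3 - l2) * (p.2 - q.2))) * c.1 +
      (-(l1 - l4) * p.1 * ((l1 - l2) * (p.1 * p.2 - q.1 * q.2)) +
        (l1 - l2) * p.1 * p.2 * ((l1 - l4) * (p.1 - q.1))) = 0 := by
    intro c hc
    have h := lin c hc
    have h1 := hc.1
    unfold OnCurve at h1
    linear_combination ((l1 - l4) * (p.1 - q.1)) * h1 -
      ((l3 - l4) * c.1 + (l1 - l4) * p.1) * h
  have h0 := quadratic_leading_coeff_eq_zero (inj c d hc.2 hd.2 hcd) (inj c e hc.2 he.2 hce)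
    (inj d e hd.2 he.2 hde) (quad c hc.2) (quad d hd.2) (quad e he.2)
  exact mul_ne_zero (mul_ne_zero (neg_ne_zero.2 (sub_ne_zero.2 h34)) (sub_ne_zero.2 h23.symm))
    (sub_ne_zero.2 hy) h0

/-- The number of parameters whose curve contains many points of a Cartesian product. -/
lemma card_rich_onCurve_le {l1 l2 l3 l4 : ℝ} (h13 : l1 ≠ l3) (h24 : l2 ≠ l4) (h34 : l3 ≠ l4)
    (h14 : l1 ≠ l4) (h23 : l2 ≠ l3) (Z : Finset (ℝ × ℝ)) (hZ : ∀ c ∈ Z, 0 < c.1 ∧ 0 < c.2)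
    (A B : Finset ℝ) (hA : ∀ x ∈ A, 0 < x) (hB : ∀ x ∈ B, 0 < x) {τ t : ℝ} (ht : 1 ≤ t)
    (htτ : t ≤ τ) (hAc : (A.card : ℝ) ≤ 2 * τ) (hBc : (B.card : ℝ) ≤ 2 * τ) :
    ((Z.filter fun c => t < (((A ×ˢ B).filter (OnCurve l1 l2 l3 l4 c.1 c.2)).card : ℝ)).card : ℝ)
      ≤ 9248 * τ ^ 4 / t ^ 3 := by
  have hpos : ∀ p ∈ A ×ˢ B, 0 < p.1 ∧ 0 < p.2 := fun p hp =>
    ⟨hA _ (Finset.mem_product.1 hp).1, hB _ (Finset.mem_product.1 hp).2⟩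
  set Y := Z.filter fun c => t < (((A ×ˢ B).filter (OnCurve l1 l2 l3 l4 c.1 c.2)).card : ℝ) with hY
  have hYZ : Y ⊆ Z := Finset.filter_subset _ _
  have hYrich : ∀ c ∈ Y, t < (((A ×ˢ B).filter (OnCurve l1 l2 l3 l4 c.1 c.2)).card : ℝ) :=
    fun c hc => (Finset.mem_filter.1 hc).2
  clear_value Y
  refine card_rich_curves_le A B Y (fun c => OnCurve l1 l2 l3 l4 c.1 c.2) ht htτ hAc hBc
    hYrich ?_ ?_
  · intro c hc
    obtain ⟨ha, hb⟩ := hZ c (hYZ hc)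
    exact OnCurve.mono_or_anti ha hb h13 h24 _ (fun p hp => hpos p (Finset.mem_filter.1 hp).1)
      fun p hp => (Finset.mem_filter.1 hp).2
  · intro p hp q hq hpq
    exact card_onCurve_le_two h13 h24 h34 h14 h23 _ (fun c hc => hZ c (hYZ hc))
      (hpos p hp).1 (hpos p hp).2 (hpos q hq).1 (hpos q hq).2 hpq

lemma card_onCurve_swap (l1 l2 l3 l4 a b : ℝ) (A B : Finset ℝ) :
    ((B ×ˢ A).filter (OnCurve l2 l1 l4 l3 b a)).card =
      ((A ×ˢ B).filter (OnCurve l1 l2 l3 l4 a b)).card := by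
  refine Finset.card_nbij' Prod.swap Prod.swap ?_ ?_ (fun _ _ => rfl) (fun _ _ => rfl)
  · intro z hz
    simp only [Finset.mem_coe, Finset.mem_filter, Finset.mem_product] at hz ⊢
    exact ⟨hz.1.symm, OnCurve.swap_iff.2 hz.2⟩
  · intro z hz
    simp only [Finset.mem_coe, Finset.mem_filter, Finset.mem_product] at hz ⊢
    exact ⟨hz.1.symm, OnCurve.swap_iff.2 hz.2⟩

/-- Some curve with parameters `a`, `b` and slopes `l1`, `l2` in `U` contains more than `t` points
of `A l1 × A l2`. -/
def HasRichCurve (U : Finset ℝ) (A : ℝ → Finset ℝ) (t l3 l4 a b : ℝ) : Prop :=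
  ∃ w ∈ U ×ˢ U, t < (((A w.1 ×ˢ A w.2).filter (OnCurve w.1 w.2 l3 l4 a b)).card : ℝ)

theorem stmt13 :
    ∃ C' : ℝ, 0 < C' ∧
      ∀ τ : ℝ, 1 ≤ τ →
      ∀ r m : ℕ, 2 ≤ r → 1 ≤ m →
      ∀ U T : Finset ℝ, Disjoint U T →
        (∀ x ∈ U, 0 < x) → (∀ x ∈ T, 0 < x) → T.card = r →
      ∀ A : ℝ → Finset ℝ, (∀ μ ∈ U, (∀ x ∈ A μ, 0 < x) ∧ ((A μ).card : ℝ) ≤ 2 * τ) →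
      ∀ X : ℝ → Finset ℝ, (∀ l ∈ T, (∀ x ∈ X l, 0 < x) ∧ (X l).card = m) →
      C' * (U.card : ℝ) ^ 2 * τ ^ ((43 : ℝ) / 25) <
        (m : ℝ) ^ 2 / (Real.exp 1 * (2 * (r : ℝ) - 3)) →
      ∃ a : ℝ → ℝ, (∀ l ∈ T, a l ∈ X l) ∧
        ∀ l3 ∈ T, ∀ l4 ∈ T, l3 ≠ l4 → ∀ l1 ∈ U, ∀ l2 ∈ U,
          ((((A l1) ×ˢ (A l2)).filter fun z =>
              (l3 * a l3 + l1 * z.1) * (a l4 + z.2) =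
                (l4 * a l4 + l2 * z.2) * (a l3 + z.1)).card : ℝ) ≤ τ ^ ((19 : ℝ) / 25) := by
  refine ⟨73984, by norm_num, ?_⟩
  intro τ hτ r m hr hm U T hUT _ _ hTr A hA X hX hlt
  have hτ0 : 0 < τ := by linarith
  set t : ℝ := τ ^ ((19 : ℝ) / 25) with ht
  have ht1 : 1 ≤ t := Real.one_le_rpow hτ (by norm_num)
  have htτ : t ≤ τ := by
    calc t ≤ τ ^ (1 : ℝ) := Real.rpow_le_rpow_of_exponent_le hτ (by norm_num)
      _ = τ := Real.rpow_one τ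
  have hpow : 9248 * τ ^ 4 / t ^ 3 = 9248 * τ ^ ((43 : ℝ) / 25) := by
    rw [ht, ← Real.rpow_natCast, ← Real.rpow_natCast, ← Real.rpow_mul hτ0.le, mul_div_assoc,
      ← Real.rpow_sub hτ0]
    norm_num
  set E : ℝ := τ ^ ((43 : ℝ) / 25)
  have hE0 : 0 < E := Real.rpow_pos_of_pos hτ0 _
  have hne : ∀ x ∈ U, ∀ y ∈ T, x ≠ y := fun x hx y hy h =>
    Finset.disjoint_left.1 hUT hx (h ▸ hy)
  have key : ∃ f : T → ℝ, (∀ l : T, f l ∈ X l) ∧ ∀ l3 l4 : T, l3 ≠ l4 →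
      ¬ HasRichCurve U A t l3 l4 (f l3) (f l4) := by
    refine exists_transversal (ι := T) (fun l => X l) (m := m) hm (fun l => (hX l l.2).2)
      (fun l3 l4 => HasRichCurve U A t l3 l4) (D := (U.card : ℝ) ^ 2 * (9248 * E)) ?_ ?_ ?_
    · rintro l3 l4 a b ⟨⟨l1, l2⟩, hw, h⟩
      refine ⟨(l2, l1), ?_, ?_⟩
      · rw [Finset.mem_product] at hw ⊢
        exact hw.symm
      · rwa [card_onCurve_swap]
    · rintro ⟨l3, h3⟩ ⟨l4, h4⟩ h34
      have h34' : l3 ≠ l4 := by simpa using h34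
      have hsub : ((X l3 ×ˢ X l4).filter fun z => HasRichCurve U A t l3 l4 z.1 z.2) ⊆
          (U ×ˢ U).biUnion fun w => (X l3 ×ˢ X l4).filter fun z =>
            t < (((A w.1 ×ˢ A w.2).filter (OnCurve w.1 w.2 l3 l4 z.1 z.2)).card : ℝ) := by
        intro z hz
        simp only [Finset.mem_filter, Finset.mem_biUnion] at hz ⊢
        obtain ⟨hz, w, hw, h⟩ := hz
        exact ⟨w, hw, hz, h⟩
      have hc := (Finset.card_le_card hsub).trans Finset.card_biUnion_le
      refine (Nat.cast_le (α := ℝ).2 hc).trans ?_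
      rw [Nat.cast_sum]
      refine (Finset.sum_le_card_nsmul _ _ (9248 * E) ?_).trans_eq ?_
      · intro w hw
        obtain ⟨h1, h2⟩ := Finset.mem_product.1 hw
        rw [← hpow]
        refine card_rich_onCurve_le (hne _ h1 _ h3) (hne _ h2 _ h4) h34' (hne _ h1 _ h4)
          (hne _ h2 _ h3) _ ?_ _ _ (hA _ h1).1 (hA _ h2).1 ht1 htτ (hA _ h1).2 (hA _ h2).2
        intro c hc
        rw [Finset.mem_product] at hc
        exact ⟨(hX l3 h3).1 _ hc.1, (hX l4 h4).1 _ hc.2⟩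
      · rw [Finset.card_product, nsmul_eq_mul]
        push_cast
        ring
    · rw [Fintype.card_coe, hTr]
      have hr' : (2 : ℝ) ≤ r := by exact_mod_cast hr
      have he : (2 : ℝ) ≤ Real.exp 1 := by linarith [Real.add_one_le_exp (1 : ℝ)]
      have hden : 0 < Real.exp 1 * (2 * (r : ℝ) - 3) := by
        have : 0 < 2 * (r : ℝ) - 3 := by linarith
        positivity
      rw [lt_div_iff₀ hden] at hlt
      refine le_trans ?_ hlt.le
      have h1 : (r : ℝ) ≤ Real.exp 1 * (2 * (r : ℝ) - 3) := by nlinarith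
      have h2 : 0 ≤ (U.card : ℝ) ^ 2 * E := by positivity
      nlinarith [mul_le_mul_of_nonneg_left h1 h2, mul_nonneg h2 hden.le]
  obtain ⟨f, hfX, hf⟩ := key
  obtain ⟨g, hg⟩ : ∃ g : ℝ → ℝ, ∀ l : T, g l = f l :=
    ⟨fun l => if h : l ∈ T then f ⟨l, h⟩ else 0, fun l => by simp⟩
  refine ⟨g, fun l hl => (hg ⟨l, hl⟩) ▸ hfX ⟨l, hl⟩, ?_⟩
  intro l3 h3 l4 h4 h34 l1 h1 l2 h2
  by_contra hcon
  rw [not_le] at hcon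
  refine hf ⟨l3, h3⟩ ⟨l4, h4⟩ (by simpa using h34) ⟨(l1, l2), Finset.mk_mem_product h1 h2, ?_⟩
  rw [← hg, ← hg]
  refine hcon.trans_eq (congrArg Nat.cast (congrArg Finset.card ?_))
  exact Finset.filter_congr fun z _ => Iff.rfl
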